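/- Let T be an L_□-theory extending PA(K) such that T ⊬ □⊥ and T ⊬ ¬□⊥. Then there is no ΔB sentence φ such that T ⊢ ¬□⊥ ↔ φ. -/

import Mathlib

namespace ModalArith

/-- Terms of the language of arithmetic L_A = {0, S, +, ×, ≤, =}. -/
inductive Term : Type
  | var : ℕ → Term
  | zero : Term
  | succ : Term → Term
  | add : Term → Term → Term
  | mul : Term → Term → Term
  deriving DecidableEq

namespace Term

/-- Free variables of a term. -/
def fv : Term → Finset ℕ
  | var x => {x}
  | zero => ∅
  | succ t => fv t
  | add t u => fv t ∪ fv u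
  | mul t u => fv t ∪ fv u

/-- Simultaneous substitution of terms for variables. -/
def substAll : Term → (ℕ → Term) → Term
  | var x, v => v x
  | zero, _ => zero
  | succ t, v => succ (substAll t v)
  | add t u, v => add (substAll t v) (substAll u v)
  | mul t u, v => mul (substAll t v) (substAll u v)

/-- Substitution of the term `s` for the variable `x`. -/
def subst (x : ℕ) (s : Term) (t : Term) : Term :=
  substAll t (Function.update Term.var x s)

/-- The numeral `n̄`. -/
def numeral : ℕ → Term
  | 0 => zero
  | n + 1 => succ (numeral n)

/-- Value of a term in the standard model under a valuation. -/
def val : Term → (ℕ → ℕ) → ℕ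
  | var x, v => v x
  | zero, _ => 0
  | succ t, v => val t v + 1
  | add t u, v => val t v + val u v
  | mul t u, v => val t v * val u v

/-- A Gödel numbering of terms. -/
def code : Term → ℕ
  | var x => Nat.pair 0 x
  | zero => Nat.pair 1 0
  | succ t => Nat.pair 2 (code t)
  | add t u => Nat.pair 3 (Nat.pair (code t) (code u))
  | mul t u => Nat.pair 4 (Nat.pair (code t) (code u))

end Term

/-- Formulas of the language L_□ of modal arithmetic. -/
inductive Formula : Type
  | falsum : Formula
  | eq : Term → Term → Formula
  | le : Term → Term → Formula
  | and : Formula → Formula → Formula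
  | or : Formula → Formula → Formula
  | imp : Formula → Formula → Formula
  | neg : Formula → Formula
  | all : ℕ → Formula → Formula
  | ex : ℕ → Formula → Formula
  | box : Formula → Formula
  deriving DecidableEq

namespace Formula

/-- Free variables of a formula. -/
def fv : Formula → Finset ℕ
  | falsum => ∅
  | eq t u => t.fv ∪ u.fv
  | le t u => t.fv ∪ u.fv
  | and φ ψ => fv φ ∪ fv ψ
  | or φ ψ => fv φ ∪ fv ψ
  | imp φ ψ => fv φ ∪ fv ψ
  | neg φ => fv φ
  | all x φ => (fv φ).erase x
  | ex x φ => (fv φ).erase x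
  | box φ => fv φ

/-- Simultaneous substitution of terms for the free variables of a formula. -/
def substAll : Formula → (ℕ → Term) → Formula
  | falsum, _ => falsum
  | eq t u, v => eq (t.substAll v) (u.substAll v)
  | le t u, v => le (t.substAll v) (u.substAll v)
  | and φ ψ, v => and (substAll φ v) (substAll ψ v)
  | or φ ψ, v => or (substAll φ v) (substAll ψ v)
  | imp φ ψ, v => imp (substAll φ v) (substAll ψ v)
  | neg φ, v => neg (substAll φ v)
  | all x φ, v => all x (substAll φ (Function.update v x (Term.var x)))
  | ex x φ, v => ex x (substAll φ (Function.update v x (Term.var x)))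
  | box φ, v => box (substAll φ v)

/-- Substitution of the term `s` for the free occurrences of the variable `x`. -/
def subst (x : ℕ) (s : Term) (φ : Formula) : Formula :=
  substAll φ (Function.update Term.var x s)

/-- The term `s` is substitutable (free) for the variable `x` in the formula. -/
def freeFor (s : Term) (x : ℕ) : Formula → Prop
  | falsum => True
  | eq _ _ => True
  | le _ _ => True
  | and φ ψ => freeFor s x φ ∧ freeFor s x ψ
  | or φ ψ => freeFor s x φ ∧ freeFor s x ψ
  | imp φ ψ => freeFor s x φ ∧ freeFor s x ψ
  | neg φ => freeFor s x φ
  | all y φ => x = y ∨ x ∉ fv φ ∨ (y ∉ s.fv ∧ freeFor s x φ)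
  | ex y φ => x = y ∨ x ∉ fv φ ∨ (y ∉ s.fv ∧ freeFor s x φ)
  | box φ => freeFor s x φ

/-- The formula is an L_A-formula (contains no □). -/
def noBox : Formula → Prop
  | falsum => True
  | eq _ _ => True
  | le _ _ => True
  | and φ ψ => noBox φ ∧ noBox ψ
  | or φ ψ => noBox φ ∧ noBox ψ
  | imp φ ψ => noBox φ ∧ noBox ψ
  | neg φ => noBox φ
  | all _ φ => noBox φ
  | ex _ φ => noBox φ
  | box _ => False

/-- Truth in the standard model ℕ under a valuation (meaningful for L_A-formulas;
boxed formulas are given the dummy value `False`). -/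
def val : Formula → (ℕ → ℕ) → Prop
  | falsum, _ => False
  | eq t u, v => t.val v = u.val v
  | le t u, v => t.val v ≤ u.val v
  | and φ ψ, v => val φ v ∧ val ψ v
  | or φ ψ, v => val φ v ∨ val ψ v
  | imp φ ψ, v => val φ v → val ψ v
  | neg φ, v => ¬ val φ v
  | all x φ, v => ∀ n : ℕ, val φ (Function.update v x n)
  | ex x φ, v => ∃ n : ℕ, val φ (Function.update v x n)
  | box _, _ => False

/-- Biconditional, as an abbreviation. -/
def iff (φ ψ : Formula) : Formula := (φ.imp ψ).and (ψ.imp φ)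

/-- `t < u` abbreviates `S t ≤ u`. -/
def lt (t u : Term) : Formula := le (Term.succ t) u

/-- Bounded universal quantification `∀ x < t, φ`. -/
def ball (x : ℕ) (t : Term) (φ : Formula) : Formula :=
  all x ((lt (Term.var x) t).imp φ)

/-- Bounded existential quantification `∃ x < t, φ`. -/
def bex (x : ℕ) (t : Term) (φ : Formula) : Formula :=
  ex x ((lt (Term.var x) t).and φ)

/-- A Gödel numbering of formulas. -/
def code : Formula → ℕ
  | falsum => Nat.pair 0 0
  | eq t u => Nat.pair 1 (Nat.pair t.code u.code)
  | le t u => Nat.pair 2 (Nat.pair t.code u.code)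
  | and φ ψ => Nat.pair 3 (Nat.pair (code φ) (code ψ))
  | or φ ψ => Nat.pair 4 (Nat.pair (code φ) (code ψ))
  | imp φ ψ => Nat.pair 5 (Nat.pair (code φ) (code ψ))
  | neg φ => Nat.pair 6 (code φ)
  | all x φ => Nat.pair 7 (Nat.pair x (code φ))
  | ex x φ => Nat.pair 8 (Nat.pair x (code φ))
  | box φ => Nat.pair 9 (code φ)

end Formula

/-- A sentence is a formula with no free variables. -/
def Sentence (φ : Formula) : Prop := φ.fv = ∅

/-- Truth in the standard model ℕ (for sentences; any fixed valuation will do). -/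
def StdTrue (φ : Formula) : Prop := φ.val fun _ => 0

/-- The logical axioms of classical first-order logic with equality for L_□,
with the identity axioms only for atomic formulas. -/
inductive LogicalAxiom : Formula → Prop
  | imp1 (φ ψ : Formula) : LogicalAxiom (φ.imp (ψ.imp φ))
  | imp2 (φ ψ χ : Formula) :
      LogicalAxiom ((φ.imp (ψ.imp χ)).imp ((φ.imp ψ).imp (φ.imp χ)))
  | dne (φ : Formula) : LogicalAxiom (φ.neg.neg.imp φ)
  | negI (φ ψ : Formula) : LogicalAxiom ((φ.imp ψ).imp ((φ.imp ψ.neg).imp φ.neg))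
  | negE (φ ψ : Formula) : LogicalAxiom (φ.neg.imp (φ.imp ψ))
  | falsumE (φ : Formula) : LogicalAxiom (Formula.falsum.imp φ)
  | negIntro (φ : Formula) : LogicalAxiom ((φ.imp Formula.falsum).imp φ.neg)
  | negElimFalsum (φ : Formula) : LogicalAxiom (φ.neg.imp (φ.imp Formula.falsum))
  | andI (φ ψ : Formula) : LogicalAxiom (φ.imp (ψ.imp (φ.and ψ)))
  | andE1 (φ ψ : Formula) : LogicalAxiom ((φ.and ψ).imp φ)
  | andE2 (φ ψ : Formula) : LogicalAxiom ((φ.and ψ).imp ψ)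
  | orI1 (φ ψ : Formula) : LogicalAxiom (φ.imp (φ.or ψ))
  | orI2 (φ ψ : Formula) : LogicalAxiom (ψ.imp (φ.or ψ))
  | orE (φ ψ χ : Formula) :
      LogicalAxiom ((φ.imp χ).imp ((ψ.imp χ).imp ((φ.or ψ).imp χ)))
  | allE (x : ℕ) (t : Term) (φ : Formula) :
      φ.freeFor t x → LogicalAxiom ((Formula.all x φ).imp (φ.subst x t))
  | allImp (x : ℕ) (φ ψ : Formula) :
      x ∉ φ.fv → LogicalAxiom ((Formula.all x (φ.imp ψ)).imp (φ.imp (Formula.all x ψ)))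
  | exI (x : ℕ) (t : Term) (φ : Formula) :
      φ.freeFor t x → LogicalAxiom ((φ.subst x t).imp (Formula.ex x φ))
  | exE (x : ℕ) (φ ψ : Formula) :
      x ∉ ψ.fv → LogicalAxiom ((Formula.all x (φ.imp ψ)).imp ((Formula.ex x φ).imp ψ))
  | eqRefl (t : Term) : LogicalAxiom (Formula.eq t t)
  | eqSymm (t u : Term) : LogicalAxiom ((Formula.eq t u).imp (Formula.eq u t))
  | eqTrans (t u w : Term) :
      LogicalAxiom ((Formula.eq t u).imp ((Formula.eq u w).imp (Formula.eq t w)))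
  | eqSucc (t u : Term) :
      LogicalAxiom ((Formula.eq t u).imp (Formula.eq t.succ u.succ))
  | eqAdd (t₁ t₂ u₁ u₂ : Term) :
      LogicalAxiom ((Formula.eq t₁ t₂).imp ((Formula.eq u₁ u₂).imp
        (Formula.eq (t₁.add u₁) (t₂.add u₂))))
  | eqMul (t₁ t₂ u₁ u₂ : Term) :
      LogicalAxiom ((Formula.eq t₁ t₂).imp ((Formula.eq u₁ u₂).imp
        (Formula.eq (t₁.mul u₁) (t₂.mul u₂))))
  | eqLe (t₁ t₂ u₁ u₂ : Term) :
      LogicalAxiom ((Formula.eq t₁ t₂).imp ((Formula.eq u₁ u₂).imp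
        ((Formula.le t₁ u₁).imp (Formula.le t₂ u₂))))

/-- Provability in an L_□-theory: logical axioms, the axioms of the theory, and the
rules modus ponens, generalization, and necessitation. -/
inductive Provable (T : Set Formula) : Formula → Prop
  | ax {φ : Formula} : φ ∈ T → Provable T φ
  | logic {φ : Formula} : LogicalAxiom φ → Provable T φ
  | mp {φ ψ : Formula} : Provable T (φ.imp ψ) → Provable T φ → Provable T ψ
  | gen {φ : Formula} (x : ℕ) : Provable T φ → Provable T (Formula.all x φ)
  | nec {φ : Formula} : Provable T φ → Provable T (Formula.box φ)

/-- First-order provability (no necessitation rule); used for the non-modal theory PA. -/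
inductive FOProvable (T : Set Formula) : Formula → Prop
  | ax {φ : Formula} : φ ∈ T → FOProvable T φ
  | logic {φ : Formula} : LogicalAxiom φ → FOProvable T φ
  | mp {φ ψ : Formula} : FOProvable T (φ.imp ψ) → FOProvable T φ → FOProvable T ψ
  | gen {φ : Formula} (x : ℕ) : FOProvable T φ → FOProvable T (Formula.all x φ)

/-- Basic (Robinson-style) axioms of arithmetic. -/
def succNeZero : Formula := (Formula.eq (Term.succ (Term.var 0)) Term.zero).neg
def succInj : Formula :=
  (Formula.eq (Term.succ (Term.var 0)) (Term.succ (Term.var 1))).imp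
    (Formula.eq (Term.var 0) (Term.var 1))
def addZero : Formula := Formula.eq (Term.add (Term.var 0) Term.zero) (Term.var 0)
def addSucc : Formula :=
  Formula.eq (Term.add (Term.var 0) (Term.succ (Term.var 1)))
    (Term.succ (Term.add (Term.var 0) (Term.var 1)))
def mulZero : Formula := Formula.eq (Term.mul (Term.var 0) Term.zero) Term.zero
def mulSucc : Formula :=
  Formula.eq (Term.mul (Term.var 0) (Term.succ (Term.var 1)))
    (Term.add (Term.mul (Term.var 0) (Term.var 1)) (Term.var 0))
def leDef : Formula :=
  (Formula.le (Term.var 0) (Term.var 1)).iff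
    (Formula.ex 2 (Formula.eq (Term.add (Term.var 0) (Term.var 2)) (Term.var 1)))

def baseAxioms : Set Formula :=
  {succNeZero, succInj, addZero, addSucc, mulZero, mulSucc, leDef}

/-- The induction axiom for the formula `φ` and the variable `x`. -/
def inductionAx (x : ℕ) (φ : Formula) : Formula :=
  ((φ.subst x Term.zero).and
    (Formula.all x (φ.imp (φ.subst x (Term.succ (Term.var x)))))).imp
      (Formula.all x φ)

/-- Peano arithmetic PA: basic axioms plus induction for L_A-formulas. -/
def PA : Set Formula :=
  baseAxioms ∪ {χ | ∃ (x : ℕ) (φ : Formula), φ.noBox ∧ χ = inductionAx x φ}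

/-- PA_□ : basic axioms plus induction for all L_□-formulas. -/
def PABox : Set Formula :=
  baseAxioms ∪ {χ | ∃ (x : ℕ) (φ : Formula), χ = inductionAx x φ}

/-- The distribution axiom K. -/
def axK (φ ψ : Formula) : Formula :=
  (Formula.box (φ.imp ψ)).imp ((Formula.box φ).imp (Formula.box ψ))

/-- PA(K). -/
def PAK : Set Formula := PABox ∪ {χ | ∃ φ ψ : Formula, χ = axK φ ψ}

/-- The axiom 4. -/
def ax4 (φ : Formula) : Formula := (Formula.box φ).imp (Formula.box (Formula.box φ))

/-- PA(K4). -/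
def PAK4 : Set Formula := PAK ∪ {χ | ∃ φ : Formula, χ = ax4 φ}

/-- The axiom of Triv. -/
def axTriv (φ : Formula) : Formula := (Formula.box φ).iff φ

/-- PA(Triv). -/
def PATriv : Set Formula := PAK ∪ {χ | ∃ φ : Formula, χ = axTriv φ}

/-- PA(Ver). -/
def PAVer : Set Formula := PAK ∪ {Formula.box Formula.falsum}

/-- `T` extends `U`: every axiom of `U` is provable in `T`. -/
def Extends (T U : Set Formula) : Prop := ∀ φ ∈ U, Provable T φ

/-- Consistency. -/
def Consistent (T : Set Formula) : Prop := ¬ Provable T Formula.falsum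

/-- The class Δ₀ of bounded L_A-formulas. -/
inductive IsDelta0 : Formula → Prop
  | falsum : IsDelta0 Formula.falsum
  | eq (t u : Term) : IsDelta0 (Formula.eq t u)
  | le (t u : Term) : IsDelta0 (Formula.le t u)
  | and {φ ψ : Formula} : IsDelta0 φ → IsDelta0 ψ → IsDelta0 (φ.and ψ)
  | or {φ ψ : Formula} : IsDelta0 φ → IsDelta0 ψ → IsDelta0 (φ.or ψ)
  | imp {φ ψ : Formula} : IsDelta0 φ → IsDelta0 ψ → IsDelta0 (φ.imp ψ)
  | neg {φ : Formula} : IsDelta0 φ → IsDelta0 φ.neg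
  | ball {x : ℕ} {t : Term} {φ : Formula} :
      x ∉ t.fv → IsDelta0 φ → IsDelta0 (Formula.ball x t φ)
  | bex {x : ℕ} {t : Term} {φ : Formula} :
      x ∉ t.fv → IsDelta0 φ → IsDelta0 (Formula.bex x t φ)

/-- The class Σ₁ of L_A-formulas. -/
inductive IsSigma1 : Formula → Prop
  | delta0 {φ : Formula} : IsDelta0 φ → IsSigma1 φ
  | and {φ ψ : Formula} : IsSigma1 φ → IsSigma1 ψ → IsSigma1 (φ.and ψ)
  | or {φ ψ : Formula} : IsSigma1 φ → IsSigma1 ψ → IsSigma1 (φ.or ψ)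
  | ex {x : ℕ} {φ : Formula} : IsSigma1 φ → IsSigma1 (Formula.ex x φ)
  | ball {x : ℕ} {t : Term} {φ : Formula} :
      x ∉ t.fv → IsSigma1 φ → IsSigma1 (Formula.ball x t φ)

/-- The class B of boxed formulas. -/
def IsB (φ : Formula) : Prop := ∃ ψ : Formula, φ = Formula.box ψ

/-- The class ΔB. -/
inductive IsDeltaB : Formula → Prop
  | delta0 {φ : Formula} : IsDelta0 φ → IsDeltaB φ
  | b (ψ : Formula) : IsDeltaB (Formula.box ψ)
  | and {φ ψ : Formula} : IsDeltaB φ → IsDeltaB ψ → IsDeltaB (φ.and ψ)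
  | or {φ ψ : Formula} : IsDeltaB φ → IsDeltaB ψ → IsDeltaB (φ.or ψ)
  | ball {x : ℕ} {t : Term} {φ : Formula} :
      x ∉ t.fv → IsDeltaB φ → IsDeltaB (Formula.ball x t φ)
  | bex {x : ℕ} {t : Term} {φ : Formula} :
      x ∉ t.fv → IsDeltaB φ → IsDeltaB (Formula.bex x t φ)

/-- The class ΣB. -/
inductive IsSigmaB : Formula → Prop
  | sigma1 {φ : Formula} : IsSigma1 φ → IsSigmaB φ
  | b (ψ : Formula) : IsSigmaB (Formula.box ψ)
  | and {φ ψ : Formula} : IsSigmaB φ → IsSigmaB ψ → IsSigmaB (φ.and ψ)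
  | or {φ ψ : Formula} : IsSigmaB φ → IsSigmaB ψ → IsSigmaB (φ.or ψ)
  | ex {x : ℕ} {φ : Formula} : IsSigmaB φ → IsSigmaB (Formula.ex x φ)
  | ball {x : ℕ} {t : Term} {φ : Formula} :
      x ∉ t.fv → IsSigmaB φ → IsSigmaB (Formula.ball x t φ)

/-- Iterated disjunction (the empty disjunction is ⊥). -/
def disj : List Formula → Formula
  | [] => Formula.falsum
  | [φ] => φ
  | φ :: ψ :: l => φ.or (disj (ψ :: l))

/-- Iterated conjunction (the empty conjunction is ⊤). -/
def conj : List Formula → Formula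
  | [] => Formula.falsum.neg
  | [φ] => φ
  | φ :: ψ :: l => φ.and (conj (ψ :: l))

/-- Γ-disjunction property. -/
def HasDP (T : Set Formula) (Γ : Formula → Prop) : Prop :=
  ∀ φ ψ : Formula, Γ φ → Γ ψ → Sentence φ → Sentence ψ →
    Provable T (φ.or ψ) → Provable T φ ∨ Provable T ψ

/-- (Γ, Θ)-disjunction property. -/
def HasDP2 (T : Set Formula) (Γ Θ : Formula → Prop) : Prop :=
  ∀ φ ψ : Formula, Γ φ → Θ ψ → Sentence φ → Sentence ψ →
    Provable T (φ.or ψ) → Provable T φ ∨ Provable T ψ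

/-- Γ-existence property. -/
def HasEP (T : Set Formula) (Γ : Formula → Prop) : Prop :=
  ∀ (x : ℕ) (φ : Formula), Γ φ → φ.fv ⊆ {x} →
    Provable T (Formula.ex x φ) → ∃ n : ℕ, Provable T (φ.subst x (Term.numeral n))

/-- Modal disjunction property. -/
def HasMDP (T : Set Formula) : Prop :=
  ∀ φ ψ : Formula, Sentence φ → Sentence ψ →
    Provable T ((Formula.box φ).or (Formula.box ψ)) → Provable T φ ∨ Provable T ψ

/-- Modal existence property. -/
def HasMEP (T : Set Formula) : Prop :=
  ∀ (x : ℕ) (φ : Formula), φ.fv ⊆ {x} →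
    Provable T (Formula.ex x (Formula.box φ)) →
      ∃ n : ℕ, Provable T (φ.subst x (Term.numeral n))

/-- n-fold B-disjunction property. -/
def HasBnDP (T : Set Formula) (n : ℕ) : Prop :=
  ∀ φ : Fin n → Formula, (∀ i, Sentence (φ i)) →
    Provable T (disj (List.ofFn fun i => Formula.box (φ i))) →
    ∃ i, Provable T (Formula.box (φ i))

/-- Σ₁-soundness. -/
def Sigma1Sound (T : Set Formula) : Prop :=
  ∀ φ : Formula, IsSigma1 φ → Sentence φ → Provable T φ → StdTrue φ

/-- L_A-soundness. -/
def LASound (T : Set Formula) : Prop :=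
  ∀ φ : Formula, φ.noBox → Sentence φ → Provable T φ → StdTrue φ

/-- `T` is recursively enumerable (via the Gödel numbering of formulas). -/
def RE (T : Set Formula) : Prop :=
  Nat.Partrec fun n => Part.assert (∃ φ ∈ T, Formula.code φ = n) fun _ => Part.some 0

/-- A fixed natural Σ₁ provability predicate `Pr_T(x)` for the theory `T`:
a Σ₁ L_A-formula with only the free variable `0` which numerates provability in `T`
in the standard model and satisfies the standard derivability conditions
(provably in PA). -/
structure ProvPred (T : Set Formula) where
  pr : Formula
  noBox : pr.noBox
  sigma1 : IsSigma1 pr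
  fvSub : pr.fv ⊆ {0}
  numerates : ∀ φ : Formula,
    StdTrue (pr.subst 0 (Term.numeral φ.code)) ↔ Provable T φ
  d1 : ∀ φ : Formula, Provable T φ → FOProvable PA (pr.subst 0 (Term.numeral φ.code))
  d2 : ∀ φ ψ : Formula,
    FOProvable PA ((pr.subst 0 (Term.numeral (φ.imp ψ).code)).imp
      ((pr.subst 0 (Term.numeral φ.code)).imp (pr.subst 0 (Term.numeral ψ.code))))
  necClosed : ∀ φ : Formula,
    FOProvable PA ((pr.subst 0 (Term.numeral φ.code)).imp
      (pr.subst 0 (Term.numeral (Formula.box φ).code)))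

/-- `Pr_T(⌜φ⌝)`. -/
def ProvPred.app {T : Set Formula} (P : ProvPred T) (φ : Formula) : Formula :=
  P.pr.subst 0 (Term.numeral φ.code)

/-- Γ-disjunctive correctness (Γ-DC). -/
def DC (T : Set Formula) (P : ProvPred T) (Γ : Formula → Prop) : Prop :=
  ∀ φ : Formula, Γ φ → Sentence φ → Provable T (φ.or (P.app φ)) → Provable T φ

/-- The substitution replacing each variable by the numeral of its value. -/
def numeralSubst (v : ℕ → ℕ) : ℕ → Term := fun x => Term.numeral (v x)

/-- Standard-model satisfaction of the ρ_T-translation: `ρ_T` is the identity on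
L_A-formulas, commutes with connectives and quantifiers, and sends `□φ(x⃗)` to
`Pr_T(⌜□φ(ẋ⃗)⌝)`, whose truth in ℕ (for a natural provability predicate) amounts to
provability in `T` of `□φ(n̄⃗)`. -/
def RhoSat (T : Set Formula) : Formula → (ℕ → ℕ) → Prop
  | .falsum, _ => False
  | .eq t u, v => t.val v = u.val v
  | .le t u, v => t.val v ≤ u.val v
  | .and φ ψ, v => RhoSat T φ v ∧ RhoSat T ψ v
  | .or φ ψ, v => RhoSat T φ v ∨ RhoSat T ψ v
  | .imp φ ψ, v => RhoSat T φ v → RhoSat T ψ v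
  | .neg φ, v => ¬ RhoSat T φ v
  | .all x φ, v => ∀ n : ℕ, RhoSat T φ (Function.update v x n)
  | .ex x φ, v => ∃ n : ℕ, RhoSat T φ (Function.update v x n)
  | .box φ, v => Provable T (Formula.box (φ.substAll (numeralSubst v)))

/-- Standard-model satisfaction of the π_T-translation: `π_T` is the identity on
L_A-formulas, commutes with connectives and quantifiers, and sends `□φ(x⃗)` to
`Pr_T(⌜φ(ẋ⃗)⌝)`, whose truth in ℕ (for a natural provability predicate) amounts to
provability in `T` of `φ(n̄⃗)`. -/
def PiSat (T : Set Formula) : Formula → (ℕ → ℕ) → Prop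
  | .falsum, _ => False
  | .eq t u, v => t.val v = u.val v
  | .le t u, v => t.val v ≤ u.val v
  | .and φ ψ, v => PiSat T φ v ∧ PiSat T ψ v
  | .or φ ψ, v => PiSat T φ v ∨ PiSat T ψ v
  | .imp φ ψ, v => PiSat T φ v → PiSat T ψ v
  | .neg φ, v => ¬ PiSat T φ v
  | .all x φ, v => ∀ n : ℕ, PiSat T φ (Function.update v x n)
  | .ex x φ, v => ∃ n : ℕ, PiSat T φ (Function.update v x n)
  | .box φ, v => Provable T (φ.substAll (numeralSubst v))

/-- Weak ΣB-soundness: every provable ΣB sentence is true in ℕ under ρ_T. -/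
def WeaklySigmaBSound (T : Set Formula) : Prop :=
  ∀ φ : Formula, IsSigmaB φ → Sentence φ → Provable T φ → RhoSat T φ fun _ => 0

/-- ΣB-soundness: every provable ΣB sentence is true in ℕ under π_T. -/
def SigmaBSound (T : Set Formula) : Prop :=
  ∀ φ : Formula, IsSigmaB φ → Sentence φ → Provable T φ → PiSat T φ fun _ => 0

end ModalArith

namespace ModalArith

/-! ### Substitution lemmas -/

theorem Term.substAll_congr (t : Term) (v w : ℕ → Term) (h : ∀ y ∈ t.fv, v y = w y) :
    t.substAll v = t.substAll w := by
  induction t with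
  | var x => exact h x (by simp [Term.fv])
  | zero => rfl
  | succ t ih => simp only [Term.substAll]; rw [ih h]
  | add t u iht ihu =>
    simp only [Term.substAll]
    rw [iht (fun y hy => h y (by simp [Term.fv, hy])),
      ihu (fun y hy => h y (by simp [Term.fv, hy]))]
  | mul t u iht ihu =>
    simp only [Term.substAll]
    rw [iht (fun y hy => h y (by simp [Term.fv, hy])),
      ihu (fun y hy => h y (by simp [Term.fv, hy]))]

theorem Term.substAll_var (t : Term) : t.substAll Term.var = t := by
  induction t with
  | var x => rfl
  | zero => rfl
  | succ t ih => simp only [Term.substAll]; rw [ih]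
  | add t u iht ihu => simp only [Term.substAll]; rw [iht, ihu]
  | mul t u iht ihu => simp only [Term.substAll]; rw [iht, ihu]

theorem Term.substAll_comp (t : Term) (v w : ℕ → Term) :
    (t.substAll v).substAll w = t.substAll (fun y => (v y).substAll w) := by
  induction t with
  | var x => rfl
  | zero => rfl
  | succ t ih => simp only [Term.substAll]; rw [ih]
  | add t u iht ihu => simp only [Term.substAll]; rw [iht, ihu]
  | mul t u iht ihu => simp only [Term.substAll]; rw [iht, ihu]

theorem numeral_fv (n : ℕ) : (Term.numeral n).fv = ∅ := by
  induction n with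
  | zero => rfl
  | succ n ih => simpa [Term.numeral, Term.fv] using ih

theorem Term.substAll_closed (t : Term) (v : ℕ → Term) (h : t.fv = ∅) : t.substAll v = t := by
  rw [Term.substAll_congr t v Term.var (by simp [h]), Term.substAll_var]

@[simp] theorem numeral_substAll (n : ℕ) (v : ℕ → Term) :
    (Term.numeral n).substAll v = Term.numeral n :=
  Term.substAll_closed _ _ (numeral_fv n)

theorem numSubst_fv (t : Term) (v : ℕ → ℕ) : (t.substAll (numeralSubst v)).fv = ∅ := by
  induction t with
  | var x => exact numeral_fv _
  | zero => rfl
  | succ t ih => exact ih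
  | add t u iht ihu => simp [Term.substAll, Term.fv, iht, ihu]
  | mul t u iht ihu => simp [Term.substAll, Term.fv, iht, ihu]

theorem Formula.substAll_congr (φ : Formula) : ∀ (v w : ℕ → Term),
    (∀ y ∈ φ.fv, v y = w y) → φ.substAll v = φ.substAll w := by
  induction φ with
  | falsum => intros; rfl
  | eq t u =>
    intro v w h
    simp only [Formula.substAll]
    rw [Term.substAll_congr t v w (fun y hy => h y (by simp [Formula.fv, hy])),
      Term.substAll_congr u v w (fun y hy => h y (by simp [Formula.fv, hy]))]
  | le t u =>
    intro v w h
    simp only [Formula.substAll]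
    rw [Term.substAll_congr t v w (fun y hy => h y (by simp [Formula.fv, hy])),
      Term.substAll_congr u v w (fun y hy => h y (by simp [Formula.fv, hy]))]
  | and a b iha ihb =>
    intro v w h
    simp only [Formula.substAll]
    rw [iha v w (fun y hy => h y (by simp [Formula.fv, hy])),
      ihb v w (fun y hy => h y (by simp [Formula.fv, hy]))]
  | or a b iha ihb =>
    intro v w h
    simp only [Formula.substAll]
    rw [iha v w (fun y hy => h y (by simp [Formula.fv, hy])),
      ihb v w (fun y hy => h y (by simp [Formula.fv, hy]))]
  | imp a b iha ihb =>
    intro v w h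
    simp only [Formula.substAll]
    rw [iha v w (fun y hy => h y (by simp [Formula.fv, hy])),
      ihb v w (fun y hy => h y (by simp [Formula.fv, hy]))]
  | neg a ih => intro v w h; simp only [Formula.substAll]; rw [ih v w h]
  | box a ih => intro v w h; simp only [Formula.substAll]; rw [ih v w h]
  | all x a ih =>
    intro v w h
    simp only [Formula.substAll]
    rw [ih _ (Function.update w x (Term.var x))]
    intro y hy
    by_cases hyx : y = x
    · subst hyx; simp
    · simp [hyx, h y (by simp [Formula.fv, hy, hyx])]
  | ex x a ih =>
    intro v w h
    simp only [Formula.substAll]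
    rw [ih _ (Function.update w x (Term.var x))]
    intro y hy
    by_cases hyx : y = x
    · subst hyx; simp
    · simp [hyx, h y (by simp [Formula.fv, hy, hyx])]

theorem Formula.substAll_var (φ : Formula) : φ.substAll Term.var = φ := by
  induction φ with
  | falsum => rfl
  | eq t u => simp only [Formula.substAll, Term.substAll_var]
  | le t u => simp only [Formula.substAll, Term.substAll_var]
  | and a b iha ihb => simp only [Formula.substAll, iha, ihb]
  | or a b iha ihb => simp only [Formula.substAll, iha, ihb]
  | imp a b iha ihb => simp only [Formula.substAll, iha, ihb]
  | neg a ih => simp only [Formula.substAll, ih]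
  | box a ih => simp only [Formula.substAll, ih]
  | all x a ih => simp only [Formula.substAll, Function.update_eq_self, ih]
  | ex x a ih => simp only [Formula.substAll, Function.update_eq_self, ih]

theorem Formula.subst_self (x : ℕ) (φ : Formula) : φ.subst x (Term.var x) = φ := by
  simp only [Formula.subst, Function.update_eq_self, Formula.substAll_var]

/-- Substitutions that cannot cause variable capture. -/
def GoodSub (v : ℕ → Term) : Prop := ∀ y, (v y).fv ⊆ {y}

theorem GoodSub.update {v : ℕ → Term} (h : GoodSub v) (x : ℕ) (t : Term) (ht : t.fv ⊆ {x}) :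
    GoodSub (Function.update v x t) := by
  intro y
  by_cases hyx : y = x
  · subst hyx; simpa using ht
  · simpa [hyx] using h y

theorem goodSub_var : GoodSub Term.var := fun y => by simp [Term.fv]

theorem goodSub_num (v : ℕ → ℕ) : GoodSub (numeralSubst v) := fun y => by
  simp [numeralSubst, numeral_fv]

theorem comp_update {v : ℕ → Term} (h : GoodSub v) (w : ℕ → Term) (x : ℕ) :
    (fun y => (Function.update v x (Term.var x) y).substAll (Function.update w x (Term.var x))) =
      Function.update (fun y => (v y).substAll w) x (Term.var x) := by
  funext y
  by_cases hyx : y = x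
  · subst hyx; simp [Term.substAll]
  · simp only [Function.update_of_ne hyx]
    apply Term.substAll_congr
    intro z hz
    have : z = y := by simpa using h y hz
    subst this
    simp [hyx]

theorem Formula.substAll_comp (φ : Formula) : ∀ (v w : ℕ → Term), GoodSub v →
    (φ.substAll v).substAll w = φ.substAll (fun y => (v y).substAll w) := by
  induction φ with
  | falsum => intros; rfl
  | eq t u => intros; simp only [Formula.substAll, Term.substAll_comp]
  | le t u => intros; simp only [Formula.substAll, Term.substAll_comp]
  | and a b iha ihb => intro v w h; simp only [Formula.substAll, iha v w h, ihb v w h]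
  | or a b iha ihb => intro v w h; simp only [Formula.substAll, iha v w h, ihb v w h]
  | imp a b iha ihb => intro v w h; simp only [Formula.substAll, iha v w h, ihb v w h]
  | neg a ih => intro v w h; simp only [Formula.substAll, ih v w h]
  | box a ih => intro v w h; simp only [Formula.substAll, ih v w h]
  | all x a ih =>
    intro v w h
    simp only [Formula.substAll]
    rw [ih _ _ (h.update x (Term.var x) (by simp [Term.fv])), comp_update h]
  | ex x a ih =>
    intro v w h
    simp only [Formula.substAll]
    rw [ih _ _ (h.update x (Term.var x) (by simp [Term.fv])), comp_update h]

theorem freeFor_good (t : Term) (x : ℕ) (ht : t.fv ⊆ {x}) (φ : Formula) : φ.freeFor t x := by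
  have key : ∀ y, x = y ∨ y ∉ t.fv := by
    intro y
    by_cases h : x = y
    · exact Or.inl h
    · exact Or.inr fun hy => h (Finset.mem_singleton.mp (ht hy)).symm
  induction φ with
  | falsum => trivial
  | eq t u => trivial
  | le t u => trivial
  | and a b iha ihb => exact ⟨iha, ihb⟩
  | or a b iha ihb => exact ⟨iha, ihb⟩
  | imp a b iha ihb => exact ⟨iha, ihb⟩
  | neg a ih => exact ih
  | box a ih => exact ih
  | all y a ih => rcases key y with h | h
                  · exact Or.inl h
                  · exact Or.inr (Or.inr ⟨h, ih⟩)
  | ex y a ih => rcases key y with h | h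
                 · exact Or.inl h
                 · exact Or.inr (Or.inr ⟨h, ih⟩)

theorem subst_succ_num (x k : ℕ) (φ : Formula) :
    (φ.subst x (Term.succ (Term.var x))).subst x (Term.numeral k) =
      φ.subst x (Term.numeral (k + 1)) := by
  unfold Formula.subst
  rw [Formula.substAll_comp _ _ _ (goodSub_var.update x _ (by simp [Term.fv]))]
  congr 1
  funext y
  by_cases hyx : y = x
  · subst hyx; simp [Term.substAll, Term.numeral]
  · simp [hyx, Term.substAll]

theorem subst_num (x k : ℕ) (v : ℕ → ℕ) (φ : Formula) :
    (φ.substAll (Function.update (numeralSubst v) x (Term.var x))).subst x (Term.numeral k) =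
      φ.substAll (numeralSubst (Function.update v x k)) := by
  unfold Formula.subst
  rw [Formula.substAll_comp _ _ _ ((goodSub_num v).update x _ (by simp [Term.fv]))]
  congr 1
  funext y
  by_cases hyx : y = x
  · subst hyx; simp [Term.substAll, numeralSubst]
  · simp [hyx, numeralSubst]

/-! ### First-order derivations -/

section FO

variable {S : Set Formula}

theorem fo_imp {a b : Formula} (h : FOProvable S b) : FOProvable S (a.imp b) :=
  .mp (.logic (.imp1 b a)) h

theorem fo_mp2 {a b c : Formula} (h : FOProvable S (a.imp (b.imp c)))
    (h' : FOProvable S (a.imp b)) : FOProvable S (a.imp c) :=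
  .mp (.mp (.logic (.imp2 a b c)) h) h'

theorem fo_tr {a b c : Formula} (h : FOProvable S (a.imp b))
    (h' : FOProvable S (b.imp c)) : FOProvable S (a.imp c) :=
  fo_mp2 (fo_imp h') h

theorem fo_neg {a : Formula} (h : FOProvable S (a.imp .falsum)) : FOProvable S a.neg :=
  .mp (.logic (.negIntro a)) h

theorem fo_bot {a : Formula} (h : FOProvable S a.neg) : FOProvable S (a.imp .falsum) :=
  .mp (.logic (.negElimFalsum a)) h

theorem fo_contra {a b : Formula} (h : FOProvable S (a.imp b)) (h' : FOProvable S b.neg) :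
    FOProvable S a.neg := fo_neg (fo_tr h (fo_bot h'))

theorem fo_inst {φ : Formula} (x : ℕ) (t : Term) (hf : φ.freeFor t x) (h : FOProvable S φ) :
    FOProvable S (φ.subst x t) :=
  .mp (.logic (.allE x t φ hf)) (.gen x h)

theorem fo_symm {t u : Term} (h : FOProvable S (.eq t u)) : FOProvable S (.eq u t) :=
  .mp (.logic (.eqSymm t u)) h

theorem fo_trans {t u w : Term} (h : FOProvable S (.eq t u)) (h' : FOProvable S (.eq u w)) :
    FOProvable S (.eq t w) :=
  .mp (.mp (.logic (.eqTrans t u w)) h) h'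

theorem fo_succ {t u : Term} (h : FOProvable S (.eq t u)) :
    FOProvable S (.eq t.succ u.succ) :=
  .mp (.logic (.eqSucc t u)) h

/-- From `t = u` (provable) get `a → t = w` out of `a → u = w`. -/
theorem fo_rwl {a : Formula} {t u w : Term} (h : FOProvable S (.eq t u))
    (h' : FOProvable S (a.imp (.eq u w))) : FOProvable S (a.imp (.eq t w)) :=
  fo_tr h' (.mp (.logic (.eqTrans t u w)) h)

theorem fo_leSub {t t' u u' : Term} (h : FOProvable S (.eq t t')) (h' : FOProvable S (.eq u u')) :
    FOProvable S ((Formula.le t u).imp (.le t' u')) :=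
  .mp (.mp (.logic (.eqLe t t' u u')) h) h'


theorem fo_base (hS : PABox ⊆ S) {φ : Formula} (h : φ ∈ baseAxioms) : FOProvable S φ := .ax (hS (Or.inl h))

theorem fo_ind (hS : PABox ⊆ S) (x : ℕ) (φ : Formula) (h0 : FOProvable S (φ.subst x .zero))
    (h1 : FOProvable S (φ.imp (φ.subst x (.succ (.var x))))) : FOProvable S φ := by
  have h : FOProvable S (inductionAx x φ) := .ax (hS (Or.inr ⟨x, φ, rfl⟩))
  have h2 : FOProvable S (.all x φ) :=
    .mp h (.mp (.mp (.logic (.andI _ _)) h0) (.gen x h1))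
  have h3 := FOProvable.mp (.logic (.allE x (.var x) φ
    (freeFor_good _ _ (by simp [Term.fv]) _))) h2
  rwa [Formula.subst_self] at h3

theorem fo_addZero (hS : PABox ⊆ S) (t : Term) : FOProvable S (.eq (t.add .zero) t) :=
  fo_inst 0 t (by simp [addZero, Formula.freeFor]) (fo_base hS (φ := addZero) (by simp [baseAxioms]))

theorem fo_mulZero (hS : PABox ⊆ S) (t : Term) : FOProvable S (.eq (t.mul .zero) .zero) :=
  fo_inst 0 t (by simp [mulZero, Formula.freeFor]) (fo_base hS (φ := mulZero) (by simp [baseAxioms]))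

theorem fo_sne (hS : PABox ⊆ S) (t : Term) : FOProvable S (Formula.eq t.succ .zero).neg :=
  fo_inst 0 t (by simp [succNeZero, Formula.freeFor])
    (fo_base hS (φ := succNeZero) (by simp [baseAxioms]))

/-- Simultaneous instances at variables 0 and 1 by two-step substitution through a variable;
only needed when the first term does not contain variable 1. -/
theorem fo_inst2 {φ : Formula} (t u : Term)
    (hf : φ.freeFor t 0) (hf' : (φ.subst 0 t).freeFor u 1) (h : FOProvable S φ) :
    FOProvable S ((φ.subst 0 t).subst 1 u) :=
  fo_inst 1 u hf' (fo_inst 0 t hf h)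

theorem subst_notin {x : ℕ} {t u : Term} (h : x ∉ t.fv) :
    t.substAll (Function.update Term.var x u) = t := by
  conv_rhs => rw [← Term.substAll_var t]
  apply Term.substAll_congr
  intro y hy
  have : y ≠ x := fun e => h (e ▸ hy)
  simp [this]

theorem fo_addSucc (hS : PABox ⊆ S) (t u : Term) (ht : 1 ∉ t.fv) :
    FOProvable S (.eq (t.add u.succ) (t.add u).succ) := by
  have h := fo_inst2 t u (by simp [addSucc, Formula.freeFor])
    (by simp [addSucc, Formula.freeFor, Formula.subst, Formula.substAll])
    (fo_base hS (φ := addSucc) (by simp [baseAxioms]))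
  simpa [addSucc, Formula.subst, Formula.substAll, Term.substAll, subst_notin ht] using h

theorem fo_mulSucc (hS : PABox ⊆ S) (t u : Term) (ht : 1 ∉ t.fv) :
    FOProvable S (.eq (t.mul u.succ) ((t.mul u).add t)) := by
  have h := fo_inst2 t u (by simp [mulSucc, Formula.freeFor])
    (by simp [mulSucc, Formula.freeFor, Formula.subst, Formula.substAll])
    (fo_base hS (φ := mulSucc) (by simp [baseAxioms]))
  simpa [mulSucc, Formula.subst, Formula.substAll, Term.substAll, subst_notin ht] using h

theorem fo_succInj (hS : PABox ⊆ S) (t u : Term) (ht : 1 ∉ t.fv) :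
    FOProvable S ((Formula.eq t.succ u.succ).imp (.eq t u)) := by
  have h := fo_inst2 t u (by simp [succInj, Formula.freeFor])
    (by simp [succInj, Formula.freeFor, Formula.subst, Formula.substAll])
    (fo_base hS (φ := succInj) (by simp [baseAxioms]))
  simpa [succInj, Formula.subst, Formula.substAll, Term.substAll, subst_notin ht] using h

theorem fo_leDef (hS : PABox ⊆ S) (t u : Term) (ht : 1 ∉ t.fv) (ht2 : 2 ∉ t.fv) (hu2 : 2 ∉ u.fv) :
    FOProvable S ((Formula.le t u).iff (.ex 2 (.eq (t.add (.var 2)) u))) := by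
  have h := fo_inst2 t u (by simp [leDef, Formula.iff, Formula.freeFor, ht2])
    (by simp [leDef, Formula.iff, Formula.freeFor, Formula.subst, Formula.substAll, hu2])
    (fo_base hS (φ := leDef) (by simp [baseAxioms]))
  have e : Function.update (Function.update Term.var 1 u) 2 (Term.var 2) =
      Function.update Term.var 1 u := by
    funext y
    by_cases hy : y = 2
    · subst hy; simp
    · simp [hy]
  simpa [leDef, Formula.iff, Formula.subst, Formula.substAll, Term.substAll, subst_notin ht, e]
    using h

theorem fo_le1 (hS : PABox ⊆ S) (t u : Term) (ht : 1 ∉ t.fv) (ht2 : 2 ∉ t.fv) (hu2 : 2 ∉ u.fv) :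
    FOProvable S ((Formula.le t u).imp (.ex 2 (.eq (t.add (.var 2)) u))) :=
  .mp (.logic (.andE1 _ _)) (fo_leDef hS t u ht ht2 hu2)

theorem fo_le2 (hS : PABox ⊆ S) (t u : Term) (ht : 1 ∉ t.fv) (ht2 : 2 ∉ t.fv) (hu2 : 2 ∉ u.fv) :
    FOProvable S ((Formula.ex 2 (.eq (t.add (.var 2)) u)).imp (.le t u)) :=
  .mp (.logic (.andE2 _ _)) (fo_leDef hS t u ht ht2 hu2)

/-- `S x + z = S (x + z)`. -/
theorem fo_succAdd (hS : PABox ⊆ S) : FOProvable S (.eq ((Term.var 0).succ.add (.var 2))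
    ((Term.var 0).add (.var 2)).succ) := by
  apply fo_ind hS 2
  · show FOProvable S (.eq ((Term.var 0).succ.add .zero) ((Term.var 0).add .zero).succ)
    exact fo_trans (fo_addZero hS _) (fo_symm (fo_succ (fo_addZero hS _)))
  · show FOProvable S (Formula.imp _ (.eq ((Term.var 0).succ.add (Term.var 2).succ)
      ((Term.var 0).add (Term.var 2).succ).succ))
    have h1 := fo_addSucc hS (Term.var 0).succ (.var 2) (by simp [Term.fv])
    have h2 := fo_succ (fo_symm (fo_addSucc hS (Term.var 0) (.var 2) (by simp [Term.fv])))
    refine fo_mp2 (b := .eq ((Term.var 0).add (Term.var 2)).succ.succ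
      ((Term.var 0).add (Term.var 2).succ).succ) ?_ (fo_imp h2)
    refine fo_tr ?_ (.logic (.eqTrans _ _ _))
    exact fo_rwl h1 (.logic (.eqSucc _ _))

/-- `S x ≤ S y → x ≤ y`. -/
theorem fo_leSS (hS : PABox ⊆ S) : FOProvable S ((Formula.le (Term.var 0).succ (Term.var 1).succ).imp
    (.le (.var 0) (.var 1))) := by
  refine fo_tr (fo_le1 hS _ _ (by simp [Term.fv]) (by simp [Term.fv]) (by simp [Term.fv])) ?_
  refine fo_tr ?_ (fo_le2 hS _ _ (by simp [Term.fv]) (by simp [Term.fv]) (by simp [Term.fv]))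
  refine .mp (.logic (.exE 2 _ _ (by simp [Formula.fv]))) (.gen 2 ?_)
  have hex := FOProvable.logic (T := S) (LogicalAxiom.exI 2 (.var 2)
    (.eq ((Term.var 0).add (.var 2)) (.var 1)) trivial)
  rw [Formula.subst_self] at hex
  refine fo_tr (fo_tr ?_ (fo_inst (S := S) 1 (Term.var 1) (by simp [Formula.freeFor])
    (φ := (Formula.eq ((Term.var 0).add (.var 2)).succ (Term.var 1).succ).imp
      (.eq ((Term.var 0).add (.var 2)) (.var 1))) ?_)) hex
  · exact fo_rwl (fo_symm (fo_succAdd hS)) (fo_tr (.mp (.mp (.logic (.imp2 _ _ _))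
      (.logic (.imp1 _ _))) (.logic (.imp1 _ .falsum))) (.mp (.mp (.logic (.imp2 _ _ _))
      (.logic (.imp1 _ _))) (.logic (.imp1 _ .falsum))))
  · -- an instance of `succInj` whose first term contains variables 0 and 2 only
    exact fo_succInj hS _ _ (by simp [Term.fv])

/-- `¬ S x ≤ 0`. -/
theorem fo_notLeZero (hS : PABox ⊆ S) : FOProvable S (Formula.le (Term.var 0).succ .zero).neg := by
  apply fo_neg
  refine fo_tr (fo_le1 hS _ _ (by simp [Term.fv]) (by simp [Term.fv]) (by simp [Term.fv])) ?_
  refine .mp (.logic (.exE 2 _ _ (by simp [Formula.fv]))) (.gen 2 ?_)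
  refine fo_tr ?_ (fo_bot (fo_sne hS ((Term.var 0).add (.var 2))))
  exact .mp (.logic (.eqTrans _ _ _)) (fo_symm (fo_succAdd hS))

theorem fo_notLeZero' (hS : PABox ⊆ S) (t : Term) : FOProvable S (Formula.le t.succ .zero).neg :=
  fo_inst 0 t (by simp [Formula.freeFor]) (fo_notLeZero hS)

theorem fo_leSS' (hS : PABox ⊆ S) (t : Term) (n : ℕ) :
    FOProvable S ((Formula.le t.succ (Term.numeral (n + 1))).imp (.le t (Term.numeral n))) := by
  have h := fo_inst 0 t (by simp [Formula.freeFor, Formula.subst, Formula.substAll])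
    (fo_inst 1 (Term.numeral n) (by simp [Formula.freeFor]) (fo_leSS hS))
  simpa [Formula.subst, Formula.substAll, Term.substAll, Term.numeral] using h

/-! ### Numerals -/

theorem fo_numAdd (hS : PABox ⊆ S) (n m : ℕ) : FOProvable S
    (.eq ((Term.numeral n).add (Term.numeral m)) (Term.numeral (n + m))) := by
  induction m with
  | zero => exact fo_addZero hS _
  | succ m ih =>
    exact fo_trans (fo_addSucc hS _ _ (by simp [numeral_fv])) (fo_succ ih)

theorem fo_numMul (hS : PABox ⊆ S) (n m : ℕ) : FOProvable S
    (.eq ((Term.numeral n).mul (Term.numeral m)) (Term.numeral (n * m))) := by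
  induction m with
  | zero => exact fo_mulZero hS _
  | succ m ih =>
    refine fo_trans (fo_mulSucc hS _ _ (by simp [numeral_fv])) ?_
    refine fo_trans (.mp (.mp (.logic (.eqAdd _ _ _ _)) ih) (.logic (.eqRefl _))) ?_
    exact fo_numAdd hS _ _

theorem fo_val (hS : PABox ⊆ S) (t : Term) (v : ℕ → ℕ) :
    FOProvable S (.eq (t.substAll (numeralSubst v)) (Term.numeral (t.val v))) := by
  induction t with
  | var x => exact .logic (.eqRefl _)
  | zero => exact .logic (.eqRefl _)
  | succ t ih => exact fo_succ ih
  | add t u iht ihu =>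
    exact fo_trans (.mp (.mp (.logic (.eqAdd _ _ _ _)) iht) ihu) (fo_numAdd hS _ _)
  | mul t u iht ihu =>
    exact fo_trans (.mp (.mp (.logic (.eqMul _ _ _ _)) iht) ihu) (fo_numMul hS _ _)

theorem fo_numNe (hS : PABox ⊆ S) : ∀ n m : ℕ, n ≠ m →
    FOProvable S (Formula.eq (Term.numeral n) (Term.numeral m)).neg
  | 0, 0, h => absurd rfl h
  | 0, m + 1, _ => fo_contra (.logic (.eqSymm _ _)) (fo_sne hS (Term.numeral m))
  | n + 1, 0, _ => fo_sne hS (Term.numeral n)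
  | n + 1, m + 1, h =>
    fo_contra (fo_succInj hS _ _ (by simp [numeral_fv])) (fo_numNe hS n m (by omega))

theorem fo_numLe (hS : PABox ⊆ S) (n m : ℕ) (h : n ≤ m) :
    FOProvable S (.le (Term.numeral n) (Term.numeral m)) := by
  refine .mp (fo_le2 hS _ _ (by simp [numeral_fv]) (by simp [numeral_fv])
    (by simp [numeral_fv])) ?_
  refine .mp (.logic (.exI 2 (Term.numeral (m - n)) _ trivial)) ?_
  have h1 := fo_numAdd hS n (m - n)
  rw [Nat.add_sub_cancel' h] at h1
  simpa [Formula.subst, Formula.substAll, Term.substAll] using h1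

theorem fo_numNotLe (hS : PABox ⊆ S) : ∀ n m : ℕ, m < n →
    FOProvable S (Formula.le (Term.numeral n) (Term.numeral m)).neg
  | 0, _, h => absurd h (by omega)
  | n + 1, 0, _ => fo_notLeZero' hS (Term.numeral n)
  | n + 1, m + 1, h => fo_contra (fo_leSS' hS _ _) (fo_numNotLe hS n m (by omega))

/-! ### Bounded quantifiers -/

theorem fo_bounded (hS : PABox ⊆ S) (x n : ℕ) : ∀ φ : Formula,
    (∀ k < n, FOProvable S (φ.subst x (Term.numeral k))) →
    FOProvable S ((Formula.lt (.var x) (Term.numeral n)).imp φ) := by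
  induction n with
  | zero =>
    intro φ _
    exact .mp (.logic (.negE _ _)) (fo_notLeZero' hS (.var x))
  | succ n ih =>
    intro φ h
    apply fo_ind hS x
    · exact fo_imp (h 0 (by omega))
    · apply fo_imp
      have h1 := ih (φ.subst x (.succ (.var x))) (fun k hk => by
        rw [subst_succ_num]; exact h (k + 1) (by omega))
      have h2 := fo_tr (fo_leSS' hS (Term.var x).succ n) h1
      simpa [Formula.subst, Formula.substAll, Formula.lt, Term.substAll] using h2

theorem fo_bounded' (hS : PABox ⊆ S) (x n : ℕ) (t : Term) (ht : FOProvable S (.eq t (Term.numeral n)))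
    (φ : Formula) (h : ∀ k < n, FOProvable S (φ.subst x (Term.numeral k))) :
    FOProvable S ((Formula.lt (.var x) t).imp φ) :=
  fo_tr (fo_leSub (.logic (.eqRefl _)) ht) (fo_bounded hS x n φ h)

theorem fo_ltTerm (hS : PABox ⊆ S) {n k : ℕ} {t : Term} (ht : FOProvable S (.eq t (Term.numeral n)))
    (hk : k < n) : FOProvable S (Formula.lt (Term.numeral k) t) :=
  .mp (fo_leSub (.logic (.eqRefl _)) (fo_symm ht)) (fo_numLe hS (k + 1) n hk)

theorem fo_ball (hS : PABox ⊆ S) {x n : ℕ} {t : Term} (ht : FOProvable S (.eq t (Term.numeral n)))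
    {φ : Formula} (h : ∀ k < n, FOProvable S (φ.subst x (Term.numeral k))) :
    FOProvable S (Formula.ball x t φ) :=
  .gen x (fo_bounded' hS x n t ht φ h)

theorem fo_notBall (hS : PABox ⊆ S) {x n k : ℕ} {t : Term} (ht : FOProvable S (.eq t (Term.numeral n)))
    (hc : t.fv = ∅) {φ : Formula} (hk : k < n)
    (h : FOProvable S (φ.subst x (Term.numeral k)).neg) :
    FOProvable S (Formula.ball x t φ).neg := by
  have h1 := FOProvable.logic (T := S) (LogicalAxiom.allE x (Term.numeral k)
    ((Formula.lt (.var x) t).imp φ) (freeFor_good _ _ (by simp [numeral_fv]) _))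
  have e : ((Formula.lt (.var x) t).imp φ).subst x (Term.numeral k) =
      (Formula.lt (Term.numeral k) t).imp (φ.subst x (Term.numeral k)) := by
    simp [Formula.subst, Formula.substAll, Formula.lt, Term.substAll, Term.substAll_closed t _ hc]
  rw [e] at h1
  exact fo_contra (fo_mp2 h1 (fo_imp (fo_ltTerm hS ht hk))) h

theorem fo_bex (hS : PABox ⊆ S) {x n k : ℕ} {t : Term} (ht : FOProvable S (.eq t (Term.numeral n)))
    (hc : t.fv = ∅) {φ : Formula} (hk : k < n)
    (h : FOProvable S (φ.subst x (Term.numeral k))) :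
    FOProvable S (Formula.bex x t φ) := by
  have h1 := FOProvable.logic (T := S) (LogicalAxiom.exI x (Term.numeral k)
    ((Formula.lt (.var x) t).and φ) (freeFor_good _ _ (by simp [numeral_fv]) _))
  have e : ((Formula.lt (.var x) t).and φ).subst x (Term.numeral k) =
      (Formula.lt (Term.numeral k) t).and (φ.subst x (Term.numeral k)) := by
    simp [Formula.subst, Formula.substAll, Formula.lt, Term.substAll, Term.substAll_closed t _ hc]
  rw [e] at h1
  exact .mp h1 (.mp (.mp (.logic (.andI _ _)) (fo_ltTerm hS ht hk)) h)

theorem fo_notBex (hS : PABox ⊆ S) {x n : ℕ} {t : Term} (ht : FOProvable S (.eq t (Term.numeral n)))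
    {φ : Formula} (h : ∀ k < n, FOProvable S (φ.subst x (Term.numeral k)).neg) :
    FOProvable S (Formula.bex x t φ).neg := by
  apply fo_neg
  refine .mp (.logic (.exE x _ _ (by simp [Formula.fv]))) (.gen x ?_)
  have h1 := fo_bounded' hS x n t ht φ.neg h
  exact fo_mp2 (fo_tr (fo_tr (.logic (.andE1 _ _)) h1) (.logic (.negElimFalsum _)))
    (.logic (.andE2 _ _))

end FO

theorem substAll_ball {x : ℕ} {t : Term} (hx : x ∉ t.fv) (φ : Formula) (v : ℕ → Term) :
    (Formula.ball x t φ).substAll v =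
      Formula.ball x (t.substAll v) (φ.substAll (Function.update v x (.var x))) := by
  have : t.substAll (Function.update v x (.var x)) = t.substAll v := by
    apply Term.substAll_congr
    intro y hy
    have : y ≠ x := fun e => hx (e ▸ hy)
    simp [this]
  simp [Formula.ball, Formula.substAll, Formula.lt, Term.substAll, this]

theorem substAll_bex {x : ℕ} {t : Term} (hx : x ∉ t.fv) (φ : Formula) (v : ℕ → Term) :
    (Formula.bex x t φ).substAll v =
      Formula.bex x (t.substAll v) (φ.substAll (Function.update v x (.var x))) := by
  have : t.substAll (Function.update v x (.var x)) = t.substAll v := by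
    apply Term.substAll_congr
    intro y hy
    have : y ≠ x := fun e => hx (e ▸ hy)
    simp [this]
  simp [Formula.bex, Formula.substAll, Formula.lt, Term.substAll, this]

theorem dec_ball {S S' : Set Formula} (hS : PABox ⊆ S) (hS' : PABox ⊆ S') {x : ℕ} {t : Term}
    {φ : Formula} (hx : x ∉ t.fv)
    (ih : ∀ v : ℕ → ℕ, FOProvable S' (φ.substAll (numeralSubst v)) ∨
      FOProvable S (φ.substAll (numeralSubst v)).neg) (v : ℕ → ℕ) :
    FOProvable S' ((Formula.ball x t φ).substAll (numeralSubst v)) ∨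
      FOProvable S ((Formula.ball x t φ).substAll (numeralSubst v)).neg := by
  rw [substAll_ball hx]
  by_cases h : ∃ k < t.val v,
      FOProvable S (φ.substAll (numeralSubst (Function.update v x k))).neg
  · obtain ⟨k, hk, h⟩ := h
    right
    refine fo_notBall hS (fo_val hS t v) (numSubst_fv t v) hk ?_
    rwa [subst_num]
  · left
    refine fo_ball hS' (fo_val hS' t v) fun k hk => ?_
    rw [subst_num]
    exact (ih _).resolve_right fun h' => h ⟨k, hk, h'⟩

theorem dec_bex {S S' : Set Formula} (hS : PABox ⊆ S) (hS' : PABox ⊆ S') {x : ℕ} {t : Term}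
    {φ : Formula} (hx : x ∉ t.fv)
    (ih : ∀ v : ℕ → ℕ, FOProvable S' (φ.substAll (numeralSubst v)) ∨
      FOProvable S (φ.substAll (numeralSubst v)).neg) (v : ℕ → ℕ) :
    FOProvable S' ((Formula.bex x t φ).substAll (numeralSubst v)) ∨
      FOProvable S ((Formula.bex x t φ).substAll (numeralSubst v)).neg := by
  rw [substAll_bex hx]
  by_cases h : ∃ k < t.val v,
      FOProvable S' (φ.substAll (numeralSubst (Function.update v x k)))
  · obtain ⟨k, hk, h⟩ := h
    left
    refine fo_bex hS' (fo_val hS' t v) (numSubst_fv t v) hk ?_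
    rwa [subst_num]
  · right
    refine fo_notBex hS (fo_val hS t v) fun k hk => ?_
    rw [subst_num]
    exact (ih _).resolve_left fun h' => h ⟨k, hk, h'⟩

theorem dec_and {S S' : Set Formula} {a b : Formula}
    (iha : FOProvable S' a ∨ FOProvable S a.neg) (ihb : FOProvable S' b ∨ FOProvable S b.neg) :
    FOProvable S' (a.and b) ∨ FOProvable S (a.and b).neg := by
  rcases iha with iha | iha
  · rcases ihb with ihb | ihb
    · exact Or.inl (.mp (.mp (.logic (.andI _ _)) iha) ihb)
    · exact Or.inr (fo_contra (.logic (.andE2 _ _)) ihb)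
  · exact Or.inr (fo_contra (.logic (.andE1 _ _)) iha)

theorem dec_or {S S' : Set Formula} {a b : Formula}
    (iha : FOProvable S' a ∨ FOProvable S a.neg) (ihb : FOProvable S' b ∨ FOProvable S b.neg) :
    FOProvable S' (a.or b) ∨ FOProvable S (a.or b).neg := by
  rcases iha with iha | iha
  · exact Or.inl (.mp (.logic (.orI1 _ _)) iha)
  · rcases ihb with ihb | ihb
    · exact Or.inl (.mp (.logic (.orI2 _ _)) ihb)
    · exact Or.inr (fo_neg (.mp (.mp (.logic (.orE _ _ _)) (fo_bot iha)) (fo_bot ihb)))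

/-- Every bounded formula is decided at numerals. -/
theorem dec_delta0 {S : Set Formula} (hS : PABox ⊆ S) {φ : Formula} (h : IsDelta0 φ) :
    ∀ v : ℕ → ℕ, FOProvable S (φ.substAll (numeralSubst v)) ∨
      FOProvable S (φ.substAll (numeralSubst v)).neg := by
  induction h with
  | falsum =>
    intro v
    exact Or.inr (fo_neg (.logic (.falsumE _)))
  | eq t u =>
    intro v
    have ht := fo_val hS t v
    have hu := fo_val hS u v
    by_cases e : t.val v = u.val v
    · rw [e] at ht
      exact Or.inl (fo_trans ht (fo_symm hu))
    · right
      refine fo_contra ?_ (fo_numNe hS _ _ e)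
      exact fo_rwl (fo_symm ht)
        (fo_mp2 (.logic (.eqTrans _ _ _)) (fo_imp hu))
  | le t u =>
    intro v
    have ht := fo_val hS t v
    have hu := fo_val hS u v
    by_cases e : t.val v ≤ u.val v
    · exact Or.inl (.mp (fo_leSub (fo_symm ht) (fo_symm hu)) (fo_numLe hS _ _ e))
    · exact Or.inr (fo_contra (fo_leSub ht hu) (fo_numNotLe hS _ _ (by omega)))
  | and _ _ iha ihb => exact fun v => dec_and (iha v) (ihb v)
  | or _ _ iha ihb => exact fun v => dec_or (iha v) (ihb v)
  | imp _ _ iha ihb =>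
    intro v
    rcases ihb v with hb | hb
    · exact Or.inl (fo_imp hb)
    · rcases iha v with ha | ha
      · right
        refine fo_contra (fo_mp2 ?_ (fo_imp ha)) hb
        exact .mp (.mp (.logic (.imp2 _ _ _)) (.logic (.imp1 _ _))) (.logic (.imp1 _ .falsum))
      · exact Or.inl (.mp (.logic (.negE _ _)) ha)
  | neg _ ih =>
    intro v
    rcases ih v with h | h
    · exact Or.inr (fo_neg (fo_mp2 (.logic (.negElimFalsum _)) (fo_imp h)))
    · exact Or.inl h
  | ball hx _ ih => exact dec_ball hS hS hx ih
  | bex hx _ ih => exact dec_bex hS hS hx ih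

theorem fo_mono {S S' : Set Formula} (h : S ⊆ S') {φ : Formula} (hp : FOProvable S φ) :
    FOProvable S' φ := by
  induction hp with
  | ax hx => exact .ax (h hx)
  | logic hx => exact .logic hx
  | mp _ _ ih1 ih2 => exact .mp ih1 ih2
  | gen x _ ih => exact .gen x ih

theorem dec_deltaB {S S' : Set Formula} (hS : PABox ⊆ S) (hSS : S ⊆ S')
    (hbox : ∀ ψ, FOProvable S' (.box ψ)) {φ : Formula} (h : IsDeltaB φ) :
    ∀ v : ℕ → ℕ, FOProvable S' (φ.substAll (numeralSubst v)) ∨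
      FOProvable S (φ.substAll (numeralSubst v)).neg := by
  have hS' := hS.trans hSS
  induction h with
  | delta0 h => exact fun v => (dec_delta0 hS h v).imp_left (fo_mono hSS)
  | b ψ => exact fun v => Or.inl (hbox _)
  | and _ _ iha ihb => exact fun v => dec_and (iha v) (ihb v)
  | or _ _ iha ihb => exact fun v => dec_or (iha v) (ihb v)
  | ball hx _ ih => exact dec_ball hS hS' hx ih
  | bex hx _ ih => exact dec_bex hS hS' hx ih

theorem fo_to_provable {T : Set Formula} {φ : Formula}
    (h : FOProvable {χ | Provable T χ} φ) : Provable T φ := by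
  induction h with
  | ax hx => exact hx
  | logic hx => exact .logic hx
  | mp _ _ ih1 ih2 => exact .mp ih1 ih2
  | gen x _ ih => exact .gen x ih

/-- The deduction theorem for the sentence `□⊥`. -/
theorem fo_deduction {T : Set Formula} {a φ : Formula} (ha : a.fv = ∅)
    (h : FOProvable (insert a {χ | Provable T χ}) φ) : Provable T (a.imp φ) := by
  induction h with
  | ax hx =>
    rcases hx with rfl | hx
    · exact .mp (.mp (.logic (.imp2 _ _ _)) (.logic (.imp1 _ _))) (.logic (.imp1 _ .falsum))
    · exact .mp (.logic (.imp1 _ _)) hx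
  | logic hx => exact .mp (.logic (.imp1 _ _)) (.logic hx)
  | mp _ _ ih1 ih2 => exact .mp (.mp (.logic (.imp2 _ _ _)) ih1) ih2
  | gen x _ ih => exact .mp (.logic (.allImp x _ _ (by simp [ha]))) (.gen x ih)

/-- If T extends PA(K), T ⊬ □⊥ and T ⊬ ¬□⊥, then no ΔB sentence is
T-provably equivalent to ¬□⊥. -/
theorem statement6 (T : Set Formula) (hT : Extends T PAK)
    (h1 : ¬ Provable T (Formula.box Formula.falsum))
    (h2 : ¬ Provable T (Formula.neg (Formula.box Formula.falsum))) :
    ¬ ∃ φ : Formula, IsDeltaB φ ∧ Sentence φ ∧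
      Provable T ((Formula.neg (Formula.box Formula.falsum)).iff φ) := by
  rintro ⟨φ, hB, hs, hp⟩
  have hS : PABox ⊆ {χ | Provable T χ} := fun χ hχ => hT χ (Or.inl hχ)
  have hbox : ∀ ψ, FOProvable (insert (Formula.box .falsum) {χ | Provable T χ}) (.box ψ) := by
    intro ψ
    have hk : Provable T (axK .falsum ψ) := hT _ (Or.inr ⟨_, _, rfl⟩)
    exact .mp (.ax (Or.inr (Provable.mp hk (.nec (.logic (.falsumE ψ))))))
      (.ax (Or.inl rfl))
  have hd := dec_deltaB hS (Set.subset_insert _ _) hbox hB (fun _ => 0)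
  have e : φ.substAll (numeralSubst fun _ => 0) = φ := by
    rw [Formula.substAll_congr φ _ Term.var (by rw [hs]; simp), Formula.substAll_var]
  rw [e] at hd
  have p1 : FOProvable {χ | Provable T χ} ((Formula.box .falsum).neg.imp φ) :=
    .mp (.logic (.andE1 _ _)) (.ax hp)
  have p2 : FOProvable {χ | Provable T χ} (φ.imp (Formula.box .falsum).neg) :=
    .mp (.logic (.andE2 _ _)) (.ax hp)
  rcases hd with hd | hd
  · apply h2
    have q : FOProvable {χ | Provable T χ} ((Formula.box .falsum).imp φ) :=
      .ax (fo_deduction (by rfl) hd)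
    have r := fo_tr (fo_tr q p2) (.logic (.negElimFalsum _))
    exact fo_to_provable (fo_neg (fo_mp2 r (.mp (.mp (.logic (.imp2 _ _ _))
      (.logic (.imp1 _ _))) (.logic (.imp1 _ .falsum)))))
  · apply h1
    exact fo_to_provable (.mp (.logic (.dne _)) (fo_contra p1 hd))

end ModalArith
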